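/- arXiv:math/0409284 — 2 statements merged into one kernel-verified Lean document; each statement's English description precedes it below -/
import Mathlib

section
/- Let k ≥ 2 and let u, v be nontrivial elements of F = FreeGroup (Fin k) such that ‖φ u‖ = ‖φ v‖ for every automorphism φ of F. Then u and v have equal Whitehead graphs with respect to every free basis of F: for every automorphism φ of F, all letters x, y with x ≠ y⁻¹, and all cyclically reduced representatives ℓ_u of φ u and ℓ_v of φ v, one has n(ℓ_u; x, y) = n(ℓ_v; x, y). -/
/-- The cyclically reduced length of an element of a free group: the minimal
reduced word length among its conjugates. -/
noncomputable def cyclLen {α : Type*} [DecidableEq α] (g : FreeGroup α) : ℕ :=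
  sInf {n : ℕ | ∃ x : FreeGroup α, FreeGroup.norm (x * g * x⁻¹) = n}

/-- `ℓ` is a cyclically reduced representative of `g`. -/
def IsCyclRep {k : ℕ} (g : FreeGroup (Fin k)) (ℓ : List (Fin k × Bool)) : Prop :=
  FreeGroup.reduce ℓ = ℓ ∧ IsConj (FreeGroup.mk ℓ) g ∧ ℓ.length = cyclLen g

/-- The inverse of a letter `(a, ε)` is `(a, !ε)`. -/
def letterInv {k : ℕ} (x : Fin k × Bool) : Fin k × Bool := (x.1, !x.2)

/-- `n(ℓ; x, y)`: the number of cyclic positions of the cyclic word `ℓ` where the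
cyclically consecutive pair of letters equals `(x, y)` or `(y⁻¹, x⁻¹)`. -/
def nPair {k : ℕ} (ℓ : List (Fin k × Bool)) (x y : Fin k × Bool) : ℕ :=
  (Finset.univ.filter (fun i : Fin ℓ.length =>
    ((ℓ.get i = x ∧
        ℓ.get ⟨(i.1 + 1) % ℓ.length,
          Nat.mod_lt _ (Nat.lt_of_le_of_lt (Nat.zero_le _) i.isLt)⟩ = y) ∨
     (ℓ.get i = letterInv y ∧
        ℓ.get ⟨(i.1 + 1) % ℓ.length,
          Nat.mod_lt _ (Nat.lt_of_le_of_lt (Nat.zero_le _) i.isLt)⟩ = letterInv x)))).card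

theorem cyclLen_le_norm_of_isConj {α : Type*} [DecidableEq α] {g h : FreeGroup α}
    (hgh : IsConj g h) : cyclLen g ≤ FreeGroup.norm h := by
  obtain ⟨c, hc⟩ := isConj_iff.1 hgh
  exact Nat.sInf_le ⟨c, by rw [hc]⟩

theorem exists_isConj_norm_eq_cyclLen {α : Type*} [DecidableEq α] (g : FreeGroup α) :
    ∃ c : FreeGroup α, FreeGroup.norm (c * g * c⁻¹) = cyclLen g :=
  Nat.sInf_mem (s := {n : ℕ | ∃ x : FreeGroup α, FreeGroup.norm (x * g * x⁻¹) = n})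
    ⟨_, 1, rfl⟩

theorem cyclLen_eq_of_isConj {α : Type*} [DecidableEq α] {g h : FreeGroup α}
    (hgh : IsConj g h) : cyclLen g = cyclLen h := by
  obtain ⟨c, hc⟩ := exists_isConj_norm_eq_cyclLen g
  obtain ⟨d, hd⟩ := exists_isConj_norm_eq_cyclLen h
  apply le_antisymm
  · rw [← hd]
    exact cyclLen_le_norm_of_isConj (hgh.trans (isConj_iff.2 ⟨d, rfl⟩))
  · rw [← hc]
    exact cyclLen_le_norm_of_isConj (hgh.symm.trans (isConj_iff.2 ⟨c, rfl⟩))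

theorem FreeGroup.norm_pow_le {α : Type*} [DecidableEq α] (g : FreeGroup α) (m : ℕ) :
    FreeGroup.norm (g ^ m) ≤ m * FreeGroup.norm g := by
  induction m with
  | zero => simp
  | succ m ih =>
    rw [pow_succ, Nat.succ_mul]
    exact (FreeGroup.norm_mul_le _ _).trans (Nat.add_le_add_right ih _)

open FreeGroup in
/-- The norm of a power grows linearly with slope the cyclically reduced length. -/
theorem exists_norm_pow_bounds {α : Type*} [DecidableEq α] (g : FreeGroup α) :
    ∃ C : ℕ, ∀ m : ℕ, m * cyclLen g ≤ norm (g ^ m) ∧ norm (g ^ m) ≤ m * cyclLen g + C := by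
  obtain ⟨c, hc⟩ := exists_isConj_norm_eq_cyclLen g
  refine ⟨norm c⁻¹ + norm c, fun m => ⟨?_, ?_⟩⟩
  · have hdec := reduceCyclically.conj_conjugator_reduceCyclically g.toWord
    have hconj : IsConj g (mk (reduceCyclically g.toWord)) := by
      rw [isConj_comm, isConj_iff]
      refine ⟨mk (reduceCyclically.conjugator g.toWord), ?_⟩
      rw [inv_mk, mul_mk, mul_mk, hdec, mk_toWord]
    have hle := (cyclLen_le_norm_of_isConj hconj).trans norm_mk_le
    rcases m with _ | m
    · simp
    · rw [FreeGroup.norm, toWord_pow, reduceCyclically.reduce_flatten_replicate_succ isReduced_toWord]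
      simp only [List.length_append, List.length_flatten, List.map_replicate, List.sum_replicate,
        smul_eq_mul]
      have := Nat.mul_le_mul_left (m + 1) hle
      omega
  · have h1 : g ^ m = c⁻¹ * (c * g * c⁻¹) ^ m * c := by
      rw [conj_pow]; group
    have h2 := norm_pow_le (c * g * c⁻¹) m
    rw [hc] at h2
    have h3 := norm_mul_le (c⁻¹ * (c * g * c⁻¹) ^ m) c
    have h4 := norm_mul_le c⁻¹ ((c * g * c⁻¹) ^ m)
    rw [h1]
    omega

open FreeGroup in
theorem IsCyclRep.isCyclicallyReduced {k : ℕ} {g : FreeGroup (Fin k)} {ℓ : List (Fin k × Bool)}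
    (h : IsCyclRep g ℓ) : IsCyclicallyReduced ℓ := by
  obtain ⟨hr, hc, hl⟩ := h
  have hred := isReduced_iff_reduce_eq.2 hr
  have hdec := reduceCyclically.conj_conjugator_reduceCyclically ℓ
  set c := reduceCyclically.conjugator ℓ
  have hconj : IsConj (mk ℓ) (mk (reduceCyclically ℓ)) := by
    rw [isConj_comm, isConj_iff]
    refine ⟨mk c, ?_⟩
    rw [inv_mk, mul_mk, mul_mk, hdec]
  have hle := (cyclLen_le_norm_of_isConj (hc.symm.trans hconj)).trans norm_mk_le
  have hlen := congrArg List.length hdec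
  simp only [List.length_append, invRev_length] at hlen
  have hc0 : c = [] := List.length_eq_zero_iff.1 (by omega)
  have : reduceCyclically ℓ = ℓ := by
    rw [hc0] at hdec
    simpa [invRev] using hdec
  rw [← this]
  exact reduceCyclically.isCyclicallyReduced hred

@[simp]
theorem letterInv_letterInv {k : ℕ} (x : Fin k × Bool) : letterInv (letterInv x) = x := by
  simp [letterInv]

@[simp]
theorem letterInv_fst {k : ℕ} (x : Fin k × Bool) : (letterInv x).1 = x.1 := rfl

@[simp]
theorem letterInv_snd {k : ℕ} (x : Fin k × Bool) : (letterInv x).2 = !x.2 := rfl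

theorem mk_letterInv {k : ℕ} (x : Fin k × Bool) :
    FreeGroup.mk [letterInv x] = (FreeGroup.mk [x])⁻¹ := by
  simp [letterInv, FreeGroup.inv_mk, FreeGroup.invRev]

/-- The number of positions of the (linear) word `ℓ` where consecutive letters form the pair
`(x, y)` or `(y⁻¹, x⁻¹)`. -/
def linPair {k : ℕ} (x y : Fin k × Bool) : List (Fin k × Bool) → ℕ
  | [] => 0
  | [_] => 0
  | p :: q :: t =>
    (if (p = x ∧ q = y) ∨ (p = letterInv y ∧ q = letterInv x) then 1 else 0) + linPair x y (q :: t)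

theorem linPair_append_cons {k : ℕ} (x y p : Fin k × Bool) (s t : List (Fin k × Bool)) :
    linPair x y (s ++ p :: t) = linPair x y (s ++ [p]) + linPair x y (p :: t) := by
  induction s with
  | nil => simp [linPair]
  | cons a s ih =>
    cases s with
    | nil => simp [linPair]
    | cons b s =>
      simp only [List.cons_append, linPair] at ih ⊢
      omega

theorem linPair_append_singleton_le {k : ℕ} (x y p : Fin k × Bool) (s : List (Fin k × Bool)) :
    linPair x y s ≤ linPair x y (s ++ [p]) ∧ linPair x y (s ++ [p]) ≤ linPair x y s + 1 := by
  induction s with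
  | nil => simp [linPair]
  | cons a s ih =>
    cases s with
    | nil =>
      simp only [List.cons_append, List.nil_append, linPair]
      split_ifs <;> simp
    | cons b s =>
      simp only [List.cons_append, linPair] at ih ⊢
      omega

theorem linPair_flatten_replicate {k : ℕ} (x y p : Fin k × Bool) (t : List (Fin k × Bool))
    (m : ℕ) : linPair x y ((List.replicate m (p :: t)).flatten ++ [p]) =
      m * linPair x y (p :: t ++ [p]) := by
  induction m with
  | zero => simp [linPair]
  | succ m ih =>
    rw [List.replicate_succ', List.flatten_concat, List.append_assoc, List.cons_append,
      linPair_append_cons, ih, Nat.succ_mul, List.cons_append]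

theorem linPair_eq_sum {k : ℕ} (x y d : Fin k × Bool) (p : Fin k × Bool)
    (t : List (Fin k × Bool)) :
    linPair x y (p :: t) = ∑ i ∈ Finset.range t.length,
      if ((p :: t).getD i d = x ∧ (p :: t).getD (i + 1) d = y) ∨
        ((p :: t).getD i d = letterInv y ∧ (p :: t).getD (i + 1) d = letterInv x)
      then 1 else 0 := by
  induction t generalizing p with
  | nil => simp [linPair]
  | cons q t ih =>
    rw [linPair, ih, List.length_cons, Finset.sum_range_succ', add_comm]
    simp only [List.getD_cons_succ, List.getD_cons_zero, zero_add]

theorem nPair_cons {k : ℕ} (x y p : Fin k × Bool) (t : List (Fin k × Bool)) :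
    nPair (p :: t) x y = linPair x y (p :: t ++ [p]) := by
  rw [List.cons_append, linPair_eq_sum x y p, nPair, Finset.card_filter]
  rw [show (t ++ [p]).length = (p :: t).length by simp, Finset.sum_range]
  refine Finset.sum_congr rfl fun i _ => ?_
  have hi := i.isLt
  have h1 : (p :: (t ++ [p])).getD i p = (p :: t).get i := by
    rw [← List.cons_append, List.getD_append _ _ _ _ hi]
    exact List.getD_eq_getElem _ _ hi
  have h2 : (p :: (t ++ [p])).getD (i + 1) p = (p :: t).get ⟨(i.1 + 1) % (p :: t).length,
      Nat.mod_lt _ (Nat.lt_of_le_of_lt (Nat.zero_le _) i.isLt)⟩ := by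
    rcases Nat.lt_or_ge (i + 1) (p :: t).length with h | h
    · rw [← List.cons_append, List.getD_append _ _ _ _ h]
      simp only [List.get_eq_getElem, Nat.mod_eq_of_lt h]
      exact List.getD_eq_getElem _ _ h
    · have : (i : ℕ) + 1 = (p :: t).length := by omega
      simp only [List.get_eq_getElem, this, Nat.mod_self]
      simp
  rw [h1, h2]

theorem nPair_letterInv {k : ℕ} (ℓ : List (Fin k × Bool)) (x y : Fin k × Bool) :
    nPair ℓ (letterInv y) (letterInv x) = nPair ℓ x y := by
  simp only [nPair, letterInv_letterInv, or_comm]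

/-- The word obtained from `ℓ` by replacing `x` by `x y⁻¹` and `x⁻¹` by `y x⁻¹`, and then cancelling
`y⁻¹ y` at each pair of consecutive letters `(x, y)` or `(y⁻¹, x⁻¹)` of `ℓ`. -/
def nielsenWord {k : ℕ} (x y : Fin k × Bool) : List (Fin k × Bool) → List (Fin k × Bool)
  | [] => []
  | [p] => if p = x then [x, letterInv y] else if p = letterInv x then [y, letterInv x] else [p]
  | p :: q :: t =>
    if p = x ∧ q = y then x :: nielsenWord x y t
    else if p = letterInv y ∧ q = letterInv x then letterInv x :: nielsenWord x y t
    else if p = x then x :: letterInv y :: nielsenWord x y (q :: t)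
    else if p = letterInv x then y :: letterInv x :: nielsenWord x y (q :: t)
    else p :: nielsenWord x y (q :: t)

theorem head?_nielsenWord {k : ℕ} (x y : Fin k × Bool) (ℓ : List (Fin k × Bool))
    (c : Fin k × Bool) (hc : (nielsenWord x y ℓ).head? = some c) :
    (c ≠ letterInv x ∧ ℓ.head? = some c) ∨ (c = y ∧ ℓ.head? = some (letterInv x)) ∨
      (c = letterInv x ∧ ℓ.head? = some (letterInv y)) := by
  have hinv : letterInv x ≠ x := by
    obtain ⟨a, b⟩ := x; cases b <;> simp [letterInv]
  fun_cases nielsenWord x y ℓ <;> grind [nielsenWord]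

theorem isReduced_cons_iff_head? {k : ℕ} {p : Fin k × Bool} {ℓ : List (Fin k × Bool)} :
    FreeGroup.IsReduced (p :: ℓ) ↔ ℓ.head? ≠ some (letterInv p) ∧ FreeGroup.IsReduced ℓ := by
  cases ℓ with
  | nil => simp
  | cons q t =>
    rw [FreeGroup.isReduced_cons_cons]
    obtain ⟨a, b⟩ := p
    obtain ⟨c, d⟩ := q
    cases b <;> cases d <;> simp [letterInv, eq_comm]

theorem isReduced_nielsenWord {k : ℕ} {x y : Fin k × Bool} (hxy : x.1 ≠ y.1)
    {ℓ : List (Fin k × Bool)} (hℓ : FreeGroup.IsReduced ℓ) :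
    FreeGroup.IsReduced (nielsenWord x y ℓ) := by
  have key := head?_nielsenWord x y
  have hne : ∀ a b : Fin k × Bool, a.1 ≠ b.1 → a ≠ b := by rintro a _ h rfl; exact h rfl
  have hinv : ∀ a : Fin k × Bool, letterInv a ≠ a := by
    rintro ⟨a, b⟩; cases b <;> simp [letterInv]
  have hinj : ∀ a b : Fin k × Bool, letterInv a = b ↔ a = letterInv b := by
    intro a b; constructor <;> rintro rfl <;> simp
  have n1 := hne x y hxy
  have n2 := hne x (letterInv y) hxy
  have n3 := hne (letterInv x) y hxy
  have n4 := hne (letterInv x) (letterInv y) hxy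
  clear hne
  fun_induction nielsenWord x y ℓ <;>
    simp only [isReduced_cons_iff_head?, List.head?_cons, List.head?_nil, FreeGroup.IsReduced.nil,
      letterInv_letterInv] at * <;> grind [letterInv_letterInv]

theorem length_nielsenWord {k : ℕ} {x y : Fin k × Bool} (hxy : x.1 ≠ y.1)
    (ℓ : List (Fin k × Bool)) :
    (nielsenWord x y ℓ).length + 2 * linPair x y ℓ =
      ℓ.length + ℓ.countP (fun p => p.1 = x.1) := by
  have hne : ∀ a b : Fin k × Bool, a.1 ≠ b.1 → a ≠ b := by rintro a _ h rfl; exact h rfl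
  have hinv : ∀ a : Fin k × Bool, letterInv a ≠ a := by
    rintro ⟨a, b⟩; cases b <;> simp [letterInv]
  have hfst : ∀ a : Fin k × Bool, a.1 = x.1 ↔ a = x ∨ a = letterInv x := by
    obtain ⟨c, d⟩ := x
    rintro ⟨a, b⟩; cases b <;> cases d <;> simp [letterInv]
  have n1 := hne x y hxy
  have n2 := hne x (letterInv y) hxy
  have n3 := hne (letterInv x) y hxy
  have n4 := hne (letterInv x) (letterInv y) hxy
  have hskip : ∀ p t, p = y ∨ p = letterInv x → linPair x y (p :: t) = linPair x y t := by
    intro p t hp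
    cases t <;> grind [linPair]
  simp only [hfst]
  fun_induction nielsenWord x y ℓ <;> grind [linPair]

theorem mk_nielsenWord {k : ℕ} {x y : Fin k × Bool} (hxy : x.1 ≠ y.1)
    (ψ : FreeGroup (Fin k) →* FreeGroup (Fin k))
    (hx : ψ (FreeGroup.mk [x]) = FreeGroup.mk [x] * (FreeGroup.mk [y])⁻¹)
    (hz : ∀ z : Fin k × Bool, z.1 ≠ x.1 → ψ (FreeGroup.mk [z]) = FreeGroup.mk [z])
    (ℓ : List (Fin k × Bool)) :
    FreeGroup.mk (nielsenWord x y ℓ) = ψ (FreeGroup.mk ℓ) := by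
  have hcons : ∀ (p : Fin k × Bool) (t : List (Fin k × Bool)),
      FreeGroup.mk (p :: t) = FreeGroup.mk [p] * FreeGroup.mk t := fun p t => by
    simp [FreeGroup.mul_mk]
  have hinvx : ψ (FreeGroup.mk [letterInv x]) = FreeGroup.mk [y] * FreeGroup.mk [letterInv x] := by
    rw [mk_letterInv, map_inv, hx, mul_inv_rev, inv_inv]
  have hy := hz y hxy.symm
  have hinvy := hz (letterInv y) hxy.symm
  have hfst : ∀ p : Fin k × Bool, p ≠ x → p ≠ letterInv x → p.1 ≠ x.1 := by
    obtain ⟨c, d⟩ := x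
    rintro ⟨a, b⟩; cases b <;> cases d <;> simp [letterInv]
  fun_induction nielsenWord x y ℓ with
  | case1 => exact (map_one ψ).symm
  | case2 => rw [hcons, mk_letterInv, hx]
  | case3 => rw [hcons, hinvx]
  | case4 p h1 h2 => exact (hz p (hfst p h1 h2)).symm
  | case5 p q t h ih =>
    rw [h.1, h.2, hcons, ih, hcons x (y :: t), hcons y, map_mul, map_mul, hx, hy]
    group
  | case6 p q t _ h ih =>
    rw [h.1, h.2, hcons, ih, hcons (letterInv y), hcons _ t, map_mul, map_mul, hinvx, hinvy,
      mk_letterInv y]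
    group
  | case7 q t _ _ ih =>
    rw [hcons, hcons (letterInv y), ih, hcons x (q :: t), map_mul, hx, mk_letterInv, mul_assoc]
  | case8 q t _ _ _ ih =>
    rw [hcons, hcons (letterInv x), ih, hcons _ (q :: t), map_mul, hinvx, mul_assoc]
  | case9 p q t _ _ h1 h2 ih =>
    rw [hcons, ih, hcons p (q :: t), map_mul, hz p (hfst p h1 h2)]

theorem exists_nielsen {k : ℕ} {x y : Fin k × Bool} (hxy : x.1 ≠ y.1) :
    ∃ ψ : FreeGroup (Fin k) ≃* FreeGroup (Fin k),
      ψ (FreeGroup.mk [x]) = FreeGroup.mk [x] * (FreeGroup.mk [y])⁻¹ ∧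
      ∀ z : Fin k × Bool, z.1 ≠ x.1 → ψ (FreeGroup.mk [z]) = FreeGroup.mk [z] := by
  let f (w : Fin k × Bool) : FreeGroup (Fin k) →* FreeGroup (Fin k) :=
    FreeGroup.lift fun c => if c = x.1 then
      (if x.2 then FreeGroup.of c * (FreeGroup.mk [w])⁻¹ else FreeGroup.mk [w] * FreeGroup.of c)
      else FreeGroup.of c
  have hfz : ∀ w z : Fin k × Bool, z.1 ≠ x.1 → f w (FreeGroup.mk [z]) = FreeGroup.mk [z] := by
    rintro w ⟨a, b⟩ hz
    cases b <;> simp_all [f, FreeGroup.of, FreeGroup.inv_mk, FreeGroup.invRev]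
  have hfx : ∀ w, f w (FreeGroup.mk [x]) = FreeGroup.mk [x] * (FreeGroup.mk [w])⁻¹ := by
    intro w
    obtain ⟨a, b⟩ := x
    cases b <;> simp [f, FreeGroup.of, FreeGroup.inv_mk, FreeGroup.invRev]
  have hcomp : ∀ w : Fin k × Bool, x.1 ≠ w.1 → (f w).comp (f (letterInv w)) = MonoidHom.id _ := by
    intro w hw
    have h1 : ∀ z : Fin k × Bool, f w (f (letterInv w) (FreeGroup.mk [z])) = FreeGroup.mk [z] →
        f w (f (letterInv w) (FreeGroup.mk [letterInv z])) = FreeGroup.mk [letterInv z] := by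
      intro z h
      rw [mk_letterInv, map_inv, map_inv, h]
    have h2 : f w (f (letterInv w) (FreeGroup.mk [x])) = FreeGroup.mk [x] := by
      rw [hfx, map_mul, map_inv, hfx, hfz w (letterInv w) hw.symm, mk_letterInv]
      group
    ext c
    change f w (f (letterInv w) (FreeGroup.mk [(c, true)])) = FreeGroup.mk [(c, true)]
    by_cases hc : c = x.1
    · subst hc
      obtain ⟨a, b⟩ := x
      cases b
      · exact h1 _ h2
      · exact h2
    · rw [hfz _ _ hc, hfz _ _ hc]
  refine ⟨(f y).toMulEquiv (f (letterInv y)) ?_ (hcomp y hxy), hfx y, hfz y⟩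
  have := hcomp (letterInv y) hxy
  rwa [letterInv_letterInv] at this

theorem Nat.eq_of_mul_le_mul_add {a b C : ℕ} (h1 : ∀ m : ℕ, m * a ≤ m * b + C)
    (h2 : ∀ m : ℕ, m * b ≤ m * a + C) : a = b := by
  rcases lt_trichotomy a b with h | h | h
  · nlinarith [h2 (C + 1)]
  · exact h
  · nlinarith [h1 (C + 1)]

/-- The cyclically reduced length of the image under the Nielsen automorphism `x ↦ x y⁻¹`. -/
theorem cyclLen_nielsen {k : ℕ} {x y : Fin k × Bool} (hxy : x.1 ≠ y.1)
    (ψ : FreeGroup (Fin k) ≃* FreeGroup (Fin k))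
    (hx : ψ (FreeGroup.mk [x]) = FreeGroup.mk [x] * (FreeGroup.mk [y])⁻¹)
    (hz : ∀ z : Fin k × Bool, z.1 ≠ x.1 → ψ (FreeGroup.mk [z]) = FreeGroup.mk [z])
    {ℓ : List (Fin k × Bool)} (hℓ : FreeGroup.IsCyclicallyReduced ℓ) :
    cyclLen (ψ (FreeGroup.mk ℓ)) + 2 * nPair ℓ x y =
      ℓ.length + ℓ.countP (fun p => p.1 = x.1) := by
  obtain ⟨C, hC⟩ := exists_norm_pow_bounds (ψ (FreeGroup.mk ℓ))
  rcases ℓ with _ | ⟨p, t⟩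
  · have := (hC 1).1
    rw [← FreeGroup.one_eq_mk, map_one] at this ⊢
    simp at this
    simp [this, nPair]
  refine Nat.eq_of_mul_le_mul_add (C := C + 2) (fun m => ?_) (fun m => ?_)
  all_goals
    have hnorm : FreeGroup.norm (ψ (FreeGroup.mk (p :: t)) ^ m) +
        2 * linPair x y (List.replicate m (p :: t)).flatten =
        m * ((p :: t).length + (p :: t).countP (fun p => p.1 = x.1)) := by
      rw [← map_pow, FreeGroup.pow_mk, ← MulEquiv.coe_toMonoidHom,
        ← mk_nielsenWord hxy ψ.toMonoidHom hx hz, FreeGroup.norm, FreeGroup.toWord_mk,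
        (isReduced_nielsenWord hxy (hℓ.flatten_replicate m).isReduced).reduce_eq,
        length_nielsenWord hxy]
      simp only [List.length_flatten, List.countP_flatten, List.map_replicate,
        List.sum_replicate, smul_eq_mul]
      ring
    have hlin := linPair_append_singleton_le x y p (List.replicate m (p :: t)).flatten
    rw [linPair_flatten_replicate, ← nPair_cons] at hlin
    have := hC m
    rw [mul_add m (cyclLen _), mul_left_comm m 2]
    omega

theorem sum_linPair {k : ℕ} (x : Fin k × Bool) {s : List (Fin k × Bool)}
    (hs : FreeGroup.IsReduced s) :
    ∑ y, linPair x y s = s.dropLast.count x + s.tail.count (letterInv x) := by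
  induction s with
  | nil => simp [linPair]
  | cons p s ih =>
    cases s with
    | nil => simp [linPair]
    | cons q t =>
      have hpq : q ≠ letterInv p := by
        have := (isReduced_cons_iff_head?.1 hs).1
        simpa using this
      have hinj : ∀ a b : Fin k × Bool, letterInv a = b ↔ a = letterInv b := by
        intro a b; constructor <;> rintro rfl <;> simp
      have hpair : ∑ y, (if (p = x ∧ q = y) ∨ (p = letterInv y ∧ q = letterInv x) then 1 else 0) =
          (if p = x then 1 else 0) + if q = letterInv x then 1 else 0 := by
        have : ∀ y, (if (p = x ∧ q = y) ∨ (p = letterInv y ∧ q = letterInv x) then 1 else 0) =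
            (if y = q then (if p = x then 1 else 0) else 0) +
              if y = letterInv p then (if q = letterInv x then 1 else 0) else 0 := by
          intro y
          grind
        simp only [this, Finset.sum_add_distrib, Finset.sum_ite_eq', Finset.mem_univ, if_true]
      simp only [linPair, Finset.sum_add_distrib]
      rw [hpair, ih (isReduced_cons_iff_head?.1 hs).2]
      simp only [List.dropLast_cons_cons, List.tail_cons, List.count_cons, beq_iff_eq]
      omega

theorem isReduced_cons_append_singleton {k : ℕ} {p : Fin k × Bool} {t : List (Fin k × Bool)}
    (h : FreeGroup.IsCyclicallyReduced (p :: t)) : FreeGroup.IsReduced (p :: t ++ [p]) := by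
  have h2 := (h.flatten_replicate 2).isReduced
  refine h2.infix ⟨[], t, ?_⟩
  simp [List.replicate_succ]

theorem sum_nPair {k : ℕ} (x : Fin k × Bool) {ℓ : List (Fin k × Bool)}
    (hℓ : FreeGroup.IsCyclicallyReduced ℓ) :
    ∑ y, nPair ℓ x y = ℓ.countP (fun p => p.1 = x.1) := by
  rcases ℓ with _ | ⟨p, t⟩
  · simp [nPair]
  · simp only [nPair_cons]
    rw [sum_linPair x (isReduced_cons_append_singleton hℓ), List.dropLast_concat, List.cons_append,
      List.tail_cons, (List.perm_append_singleton p t).count_eq]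
    generalize p :: t = s
    have hfst : ∀ a : Fin k × Bool, a.1 = x.1 ↔ a = x ∨ a = letterInv x := by
      obtain ⟨c, d⟩ := x
      rintro ⟨a, b⟩; cases b <;> cases d <;> simp [letterInv]
    have hinv : x ≠ letterInv x := by
      obtain ⟨a, b⟩ := x
      cases b <;> simp [letterInv]
    simp only [hfst]
    induction s with
    | nil => simp
    | cons a s ih => grind

theorem nPair_letterInv_right {k : ℕ} (x : Fin k × Bool) {ℓ : List (Fin k × Bool)}
    (hℓ : FreeGroup.IsCyclicallyReduced ℓ) : nPair ℓ x (letterInv x) = 0 := by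
  rcases ℓ with _ | ⟨p, t⟩
  · simp [nPair]
  · rw [nPair_cons]
    have h := isReduced_cons_append_singleton hℓ
    generalize p :: t ++ [p] = s at h
    induction s with
    | nil => simp [linPair]
    | cons a s ih =>
      rw [isReduced_cons_iff_head?] at h
      cases s with
      | nil => simp [linPair]
      | cons b s =>
        rw [linPair, ih h.2]
        have := h.1
        grind [letterInv_letterInv]

theorem sum_countP_fst {k : ℕ} (ℓ : List (Fin k × Bool)) :
    ∑ a, ℓ.countP (fun p => p.1 = a) = ℓ.length := by
  induction ℓ with
  | nil => simp
  | cons p t ih => simp [List.countP_cons, Finset.sum_add_distrib, ih]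

theorem equal_cyclic_lengths_implies_equal_whitehead_graphs {k : ℕ} (hk : 2 ≤ k)
    (u v : FreeGroup (Fin k)) (hu : u ≠ 1) (hv : v ≠ 1)
    (hlen : ∀ φ : FreeGroup (Fin k) ≃* FreeGroup (Fin k), cyclLen (φ u) = cyclLen (φ v)) :
    ∀ φ : FreeGroup (Fin k) ≃* FreeGroup (Fin k),
      ∀ x y : Fin k × Bool, x ≠ letterInv y →
        ∀ ℓu ℓv : List (Fin k × Bool),
          IsCyclRep (φ u) ℓu → IsCyclRep (φ v) ℓv →
            nPair ℓu x y = nPair ℓv x y := by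
  intro φ x y hxy ℓu ℓv hℓu hℓv
  have hcu := hℓu.isCyclicallyReduced
  have hcv := hℓv.isCyclicallyReduced
  have hL : ℓu.length = ℓv.length := by rw [hℓu.2.2, hℓv.2.2, hlen]
  have hnielsen : ∀ x y : Fin k × Bool, x.1 ≠ y.1 →
      ℓu.countP (fun p => p.1 = x.1) + 2 * nPair ℓv x y =
        ℓv.countP (fun p => p.1 = x.1) + 2 * nPair ℓu x y := by
    intro x y hxy
    obtain ⟨ψ, hx, hz⟩ := exists_nielsen hxy
    have h1 := cyclLen_nielsen hxy ψ hx hz hcu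
    have h2 := cyclLen_nielsen hxy ψ hx hz hcv
    have h3 : cyclLen (ψ (FreeGroup.mk ℓu)) = cyclLen (ψ (FreeGroup.mk ℓv)) := by
      have hψ : ∀ {g h : FreeGroup (Fin k)}, IsConj g h → cyclLen (ψ g) = cyclLen (ψ h) :=
        fun h => cyclLen_eq_of_isConj (ψ.toMonoidHom.map_isConj h)
      rw [hψ hℓu.2.1, hψ hℓv.2.1]
      exact hlen (φ.trans ψ)
    omega
  have hdiff : ∀ a b : Fin k, ℓu.countP (fun p => p.1 = a) + ℓv.countP (fun p => p.1 = b) =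
      ℓv.countP (fun p => p.1 = a) + ℓu.countP (fun p => p.1 = b) := by
    intro a b
    rcases eq_or_ne a b with rfl | hab
    · exact add_comm _ _
    · have h1 := hnielsen (a, true) (b, true) hab
      have h2 : ℓu.countP (fun p => p.1 = b) + 2 * nPair ℓv (letterInv (b, true))
          (letterInv (a, true)) = ℓv.countP (fun p => p.1 = b) + 2 * nPair ℓu (letterInv (b, true))
          (letterInv (a, true)) := hnielsen (letterInv (b, true)) _ hab.symm
      rw [nPair_letterInv, nPair_letterInv] at h2
      dsimp only at h1
      omega
  have hdeg : ∀ a : Fin k, ℓu.countP (fun p => p.1 = a) = ℓv.countP (fun p => p.1 = a) := by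
    intro a
    have h := Finset.sum_congr (rfl : (Finset.univ : Finset (Fin k)) = _) fun b _ => hdiff a b
    simp only [Finset.sum_add_distrib, sum_countP_fst, hL, Finset.sum_const, Finset.card_univ,
      Fintype.card_fin, smul_eq_mul, add_left_inj] at h
    exact Nat.eq_of_mul_eq_mul_left (by omega) h
  have hne : ∀ y : Fin k × Bool, x.1 ≠ y.1 → nPair ℓu x y = nPair ℓv x y := by
    intro y h
    have := hnielsen x y h
    rw [hdeg] at this
    omega
  by_cases h : x.1 = y.1
  · have hyx : y = x := by
      obtain ⟨a, b⟩ := x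
      obtain ⟨c, d⟩ := y
      cases b <;> cases d <;> simp_all [letterInv]
    subst hyx
    have hsum : ∑ z, nPair ℓu y z = ∑ z, nPair ℓv y z := by
      rw [sum_nPair y hcu, sum_nPair y hcv, hdeg]
    rw [← Finset.add_sum_erase _ _ (Finset.mem_univ y),
      ← Finset.add_sum_erase _ _ (Finset.mem_univ y)] at hsum
    have herase : ∑ z ∈ Finset.univ.erase y, nPair ℓu y z =
        ∑ z ∈ Finset.univ.erase y, nPair ℓv y z := by
      refine Finset.sum_congr rfl fun z hzy => ?_
      by_cases hz : y.1 = z.1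
      · have : z = letterInv y := by
          have := Finset.ne_of_mem_erase hzy
          obtain ⟨a, b⟩ := y
          obtain ⟨c, d⟩ := z
          cases b <;> cases d <;> simp_all [letterInv]
        rw [this, nPair_letterInv_right y hcu, nPair_letterInv_right y hcv]
      · exact hne z hz
    omega
  · exact hne y h
end

section
/- Let k ≥ 2 and let g, h ∈ FreeGroup (Fin k) be translation equivalent elements with g ≠ h⁻¹. Then for all positive integers p, q, i, j with p + q = i + j, the elements g^p * h^q and g^i * h^j are translation equivalent in FreeGroup (Fin k): for every automorphism φ of FreeGroup (Fin k), ‖φ (g^p * h^q)‖ = ‖φ (g^i * h^j)‖. -/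
/-- Translation equivalence (combinatorial form): equal cyclically reduced length
with respect to every free basis. -/
def TransEquiv {k : ℕ} (g h : FreeGroup (Fin k)) : Prop :=
  ∀ φ : FreeGroup (Fin k) ≃* FreeGroup (Fin k), cyclLen (φ g) = cyclLen (φ h)

namespace FreeGroup

variable {α : Type*} {A B C G S V L : List (α × Bool)}

/-- The word `L` repeated `n` times. -/
def wordPow (L : List (α × Bool)) (n : ℕ) : List (α × Bool) :=
  (List.replicate n L).flatten

theorem wordPow_succ (L : List (α × Bool)) (n : ℕ) : wordPow L (n + 1) = L ++ wordPow L n := by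
  simp [wordPow, List.replicate_succ]

theorem wordPow_succ' (L : List (α × Bool)) (n : ℕ) : wordPow L (n + 1) = wordPow L n ++ L := by
  simp [wordPow, List.replicate_succ']

theorem length_wordPow (L : List (α × Bool)) (n : ℕ) : (wordPow L n).length = n * L.length := by
  simp [wordPow]

theorem mk_wordPow (L : List (α × Bool)) (n : ℕ) : mk (wordPow L n) = mk L ^ n :=
  (pow_mk n).symm

theorem append_wordPow (A S : List (α × Bool)) (n : ℕ) :
    A ++ wordPow (S ++ A) n = wordPow (A ++ S) n ++ A := by
  induction n with
  | zero => simp [wordPow]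
  | succ n ih => rw [wordPow_succ', wordPow_succ', ← List.append_assoc, ih]; simp

theorem IsCyclicallyReduced.wordPow (h : IsCyclicallyReduced L) (n : ℕ) :
    IsCyclicallyReduced (wordPow L n) :=
  h.flatten_replicate n

theorem isReduced_append_iff : IsReduced (A ++ B) ↔ IsReduced A ∧ IsReduced B ∧
    ∀ a ∈ A.getLast?, ∀ b ∈ B.head?, a.1 = b.1 → a.2 = b.2 :=
  List.isChain_append

theorem IsReduced.append_congr {A' B' : List (α × Bool)} (h : IsReduced (A ++ B))
    (hA : IsReduced A') (hB : IsReduced B') (hlast : A'.getLast? = A.getLast?)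
    (hhead : B'.head? = B.head?) : IsReduced (A' ++ B') := by
  rw [isReduced_append_iff] at h ⊢
  rw [hlast, hhead]
  exact ⟨hA, hB, h.2.2⟩

theorem IsCyclicallyReduced.of_append (hA : A ≠ []) (hB : B ≠ []) (hAB : IsReduced (A ++ B))
    (hBA : IsReduced (B ++ A)) : IsCyclicallyReduced (A ++ B) := by
  refine ⟨hAB, ?_⟩
  rw [List.getLast?_append_of_ne_nil _ hB, List.head?_append_of_ne_nil _ hA]
  exact (isReduced_append_iff.1 hBA).2.2

theorem IsCyclicallyReduced.rotate (h : IsCyclicallyReduced (A ++ B)) :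
    IsCyclicallyReduced (B ++ A) := by
  have h3 : IsReduced ((B ++ A) ++ (B ++ A)) :=
    (h.wordPow 3).isReduced.infix ⟨A, B, by simp [FreeGroup.wordPow, List.replicate_succ]⟩
  exact ⟨(isReduced_append_iff.1 h3).1, (isReduced_append_iff.1 h3).2.2⟩

theorem exists_cancel_of_not_isReduced_append (hA : IsReduced A) (hB : IsReduced B)
    (h : ¬ IsReduced (A ++ B)) :
    ∃ (t : α × Bool) (A' B' : List (α × Bool)), A = A' ++ [t] ∧ B = invRev [t] ++ B' := by
  simp only [isReduced_append_iff, hA, hB, true_and, not_forall] at h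
  obtain ⟨⟨a, x⟩, ha, ⟨b, y⟩, hb, hab, hne⟩ := h
  obtain ⟨A', rfl⟩ := List.getLast?_eq_some_iff.1 ha
  obtain ⟨B', rfl⟩ := List.head?_eq_some_iff.1 hb
  refine ⟨(a, x), A', B', rfl, ?_⟩
  cases x <;> cases y <;> simp_all [invRev]

theorem mk_conj (U C : List (α × Bool)) :
    mk (U ++ C ++ invRev U) = mk U * mk C * (mk U)⁻¹ := by
  simp [← mul_mk, inv_mk, mul_assoc]

variable [DecidableEq α]

theorem norm_mk_of_isReduced (h : IsReduced L) : norm (mk L) = L.length := by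
  rw [norm, toWord_mk, h.reduce_eq]

theorem norm_pow_le_s5 (g : FreeGroup α) (n : ℕ) : norm (g ^ n) ≤ n * norm g := by
  induction n with
  | zero => simp
  | succ n ih =>
    rw [pow_succ]
    linarith [norm_mul_le (g ^ n) g]

theorem length_le_norm_conj (h : IsCyclicallyReduced L) (x : FreeGroup α) :
    L.length ≤ norm (x * mk L * x⁻¹) := by
  by_contra! hlt
  set n := 2 * norm x + 1 with hn
  have h1 : norm (mk L ^ n) = n * L.length := by
    rw [← mk_wordPow, norm_mk_of_isReduced (h.wordPow n).isReduced, length_wordPow]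
  have h2 : mk L ^ n = x⁻¹ * (x * mk L * x⁻¹) ^ n * x := by rw [conj_pow]; group
  have h3 := norm_mul_le (x⁻¹ * (x * mk L * x⁻¹) ^ n) x
  have h4 := norm_mul_le x⁻¹ ((x * mk L * x⁻¹) ^ n)
  have h5 := norm_pow_le_s5 (x * mk L * x⁻¹) n
  rw [← h2, h1] at h3
  rw [norm_inv_eq] at h4
  have h6 := Nat.mul_le_mul_left n hlt
  rw [Nat.succ_eq_add_one, mul_add] at h6
  omega

theorem cyclLen_eq_length {g x : FreeGroup α} (hL : IsCyclicallyReduced L)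
    (hx : x * g * x⁻¹ = mk L) : cyclLen g = L.length := by
  apply le_antisymm
  · exact Nat.sInf_le ⟨x, by rw [hx, norm_mk_of_isReduced hL.isReduced]⟩
  · refine le_csInf ⟨_, 1, rfl⟩ ?_
    rintro _ ⟨y, rfl⟩
    have hg : y * g * y⁻¹ = (y * x⁻¹) * mk L * (y * x⁻¹)⁻¹ := by rw [← hx]; group
    rw [hg]
    exact length_le_norm_conj hL _

theorem exists_conj_cyclicallyReduced (g : FreeGroup α) :
    ∃ U C : List (α × Bool), IsCyclicallyReduced C ∧ IsReduced (U ++ C ++ invRev U) ∧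
      g = mk (U ++ C ++ invRev U) := by
  refine ⟨reduceCyclically.conjugator g.toWord, reduceCyclically g.toWord,
    reduceCyclically.isCyclicallyReduced isReduced_toWord, ?_, ?_⟩ <;>
  rw [reduceCyclically.conj_conjugator_reduceCyclically]
  · exact isReduced_toWord
  · exact mk_toWord.symm

theorem exists_conj_eq_mk (g : FreeGroup α) :
    ∃ (x : FreeGroup α) (C : List (α × Bool)), IsCyclicallyReduced C ∧ x * g * x⁻¹ = mk C := by
  obtain ⟨U, C, hC, -, hg⟩ := exists_conj_cyclicallyReduced g
  exact ⟨(mk U)⁻¹, C, hC, by rw [hg, mk_conj]; group⟩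

theorem eq_one_of_cyclLen_eq_zero {g : FreeGroup α} (hg : cyclLen g = 0) : g = 1 := by
  obtain ⟨x, C, hC, hx⟩ := exists_conj_eq_mk g
  rw [cyclLen_eq_length hC hx, List.length_eq_zero_iff] at hg
  rw [hg, ← one_eq_mk] at hx
  exact conj_eq_one_iff.1 hx

/-- The case in which the axes of `g` and `h` in the Cayley tree are disjoint. -/
theorem cyclLen_pow_mul_pow_of_disjoint {g h x : FreeGroup α} (hG : IsCyclicallyReduced G)
    (hC : IsCyclicallyReduced C) (hV : V ≠ []) (hG0 : G ≠ [])
    (hVCV : IsReduced (V ++ C ++ invRev V)) (hGV : IsReduced (G ++ V))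
    (hVG : IsReduced (invRev V ++ G)) (hg : x * g * x⁻¹ = mk G)
    (hh : x * h * x⁻¹ = mk (V ++ C ++ invRev V)) {p q : ℕ} (hp : 0 < p) (hq : 0 < q) :
    cyclLen (g ^ p * h ^ q) = p * G.length + q * C.length + 2 * V.length := by
  obtain ⟨p, rfl⟩ := Nat.exists_eq_add_one_of_ne_zero hp.ne'
  have hW : IsReduced (V ++ wordPow C q ++ invRev V) :=
    IsReduced.append_flatten_replicate_append hC hVCV hq.ne'
  have hV' : invRev V ≠ [] := by simpa [invRev] using hV
  have hP := (hG.wordPow (p + 1)).isReduced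
  have hlast : (wordPow G (p + 1)).getLast? = G.getLast? := by
    rw [wordPow_succ', List.getLast?_append_of_ne_nil _ hG0]
  have hhead : (wordPow G (p + 1)).head? = G.head? := by
    rw [wordPow_succ, List.head?_append_of_ne_nil _ hG0]
  have hcyc : IsCyclicallyReduced (wordPow G (p + 1) ++ (V ++ wordPow C q ++ invRev V)) := by
    refine .of_append (by simp [wordPow_succ, hG0]) (by simp [hV])
      (hGV.append_congr hP hW hlast ?_) (hVG.append_congr hW hP ?_ hhead)
    · rw [List.append_assoc, List.head?_append_of_ne_nil _ hV]
    · rw [List.getLast?_append_of_ne_nil _ hV']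
  rw [cyclLen_eq_length (x := x) hcyc]
  · simp [length_wordPow]
    ring
  · rw [← mul_mk, mk_conj, mk_wordPow, mk_wordPow, ← conj_pow, ← mk_conj, ← hg, ← hh, conj_pow,
      conj_pow]
    group

/-- The case in which the axes of `g` and `h` in the Cayley tree meet, and are traversed in
opposite directions along a common segment `S`. -/
theorem cyclLen_pow_mul_pow_of_overlap {g h x : FreeGroup α} (hSA : IsCyclicallyReduced (S ++ A))
    (hBS : IsCyclicallyReduced (B ++ invRev S)) (hA : A ≠ []) (hB : B ≠ [])
    (hAB : IsReduced (A ++ B)) (hBA : IsReduced (B ++ A)) (hg : x * g * x⁻¹ = mk (S ++ A))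
    (hh : x * h * x⁻¹ = mk (B ++ invRev S)) {p q : ℕ} (hp : 0 < p) (hq : 0 < q) :
    cyclLen (g ^ p * h ^ q) + 2 * S.length =
      p * (S ++ A).length + q * (B ++ invRev S).length := by
  obtain ⟨p, rfl⟩ := Nat.exists_eq_add_one_of_ne_zero hp.ne'
  obtain ⟨q, rfl⟩ := Nat.exists_eq_add_one_of_ne_zero hq.ne'
  set W₁ := A ++ wordPow (S ++ A) p with hW₁
  set W₂ := wordPow (B ++ invRev S) q ++ B with hW₂
  have hr₁ : IsReduced W₁ := (hSA.wordPow (p + 1)).isReduced.infix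
    ⟨S, [], by simp [hW₁, wordPow_succ]⟩
  have hr₂ : IsReduced W₂ := (hBS.wordPow (q + 1)).isReduced.infix
    ⟨[], invRev S, by simp [hW₂, wordPow_succ']⟩
  have hlast₁ : W₁.getLast? = A.getLast? := by
    rw [hW₁, append_wordPow, List.getLast?_append_of_ne_nil _ hA]
  have hhead₁ : W₁.head? = A.head? := List.head?_append_of_ne_nil _ hA
  have hlast₂ : W₂.getLast? = B.getLast? := List.getLast?_append_of_ne_nil _ hB
  have hhead₂ : W₂.head? = B.head? := by
    rw [hW₂, ← append_wordPow, List.head?_append_of_ne_nil _ hB]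
  have hcyc : IsCyclicallyReduced (W₁ ++ W₂) :=
    .of_append (by simp [hW₁, hA]) (by simp [hW₂, hB])
      (hAB.append_congr hr₁ hr₂ hlast₁ hhead₂) (hBA.append_congr hr₂ hr₁ hlast₂ hhead₁)
  rw [cyclLen_eq_length (x := (mk S)⁻¹ * x) hcyc]
  · simp [hW₁, hW₂, length_wordPow]
    ring
  · have h₁ : mk S * mk W₁ = x * g ^ (p + 1) * x⁻¹ := by
      rw [mul_mk, hW₁, ← List.append_assoc, ← wordPow_succ, mk_wordPow, ← hg, conj_pow]
    have h₂ : mk W₂ * (mk S)⁻¹ = x * h ^ (q + 1) * x⁻¹ := by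
      rw [inv_mk, mul_mk, hW₂, List.append_assoc, ← wordPow_succ', mk_wordPow, ← hh, conj_pow]
    rw [← mul_mk, eq_inv_mul_of_mul_eq h₁, eq_mul_of_mul_inv_eq h₂]
    group

/-- Common conjugates of `g` and `h` with `g` cyclically reduced and the axis of `h` as close as
possible to the base point. -/
theorem exists_conj_disjoint_or_cyclicallyReduced (g h : FreeGroup α) :
    ∃ (x : FreeGroup α) (G V C : List (α × Bool)), IsCyclicallyReduced G ∧
      IsCyclicallyReduced C ∧ IsReduced (V ++ C ++ invRev V) ∧ x * g * x⁻¹ = mk G ∧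
      x * h * x⁻¹ = mk (V ++ C ++ invRev V) ∧
      (V ≠ [] → IsReduced (G ++ V) ∧ IsReduced (invRev V ++ G)) := by
  classical
  let P (n : ℕ) : Prop := ∃ (x : FreeGroup α) (G V C : List (α × Bool)), IsCyclicallyReduced G ∧
      IsCyclicallyReduced C ∧ IsReduced (V ++ C ++ invRev V) ∧ x * g * x⁻¹ = mk G ∧
      x * h * x⁻¹ = mk (V ++ C ++ invRev V) ∧ V.length = n
  have hP : ∃ n, P n := by
    obtain ⟨x, G, hG, hg⟩ := exists_conj_eq_mk g
    obtain ⟨V, C, hC, hV, hh⟩ := exists_conj_cyclicallyReduced (x * h * x⁻¹)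
    exact ⟨_, x, G, V, C, hG, hC, hV, hg, hh, rfl⟩
  obtain ⟨x, G, V, C, hG, hC, hVC, hg, hh, hn⟩ := Nat.find_spec hP
  refine ⟨x, G, V, C, hG, hC, hVC, hg, hh, fun hV ↦ ?_⟩
  obtain ⟨t, V, rfl⟩ := List.exists_cons_of_ne_nil hV
  have hinv : invRev (t :: V) = invRev V ++ invRev [t] := invRev_cons
  have hrV : IsReduced (t :: V) := hVC.infix ⟨[], C ++ invRev (t :: V), by simp⟩
  have hrV' : IsReduced (invRev (t :: V)) := hVC.infix ⟨t :: V ++ C, [], by simp⟩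
  have hVC' : IsReduced (V ++ C ++ invRev V) := hVC.infix ⟨[t], invRev [t], by simp [hinv]⟩
  have key : ∀ G', IsCyclicallyReduced G' → mk G' = (mk [t])⁻¹ * mk G * mk [t] → False := by
    intro G' hG' hGG'
    refine Nat.find_min hP (m := V.length) (by simp [← hn]) ⟨(mk [t])⁻¹ * x, G', V, C, hG', hC,
      hVC', ?_, ?_, rfl⟩
    · rw [hGG', ← hg]; group
    · have : mk (t :: V) = mk [t] * mk V := by rw [mul_mk]; rfl
      calc (mk [t])⁻¹ * x * h * ((mk [t])⁻¹ * x)⁻¹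
          = (mk [t])⁻¹ * (x * h * x⁻¹) * mk [t] := by group
        _ = _ := by rw [hh, mk_conj, mk_conj, this]; group
  constructor
  · by_contra hr
    obtain ⟨s, G', V', rfl, hs⟩ := exists_cancel_of_not_isReduced_append hG.isReduced hrV hr
    have hst : mk [t] = (mk [s])⁻¹ := by
      rw [inv_mk]
      simp only [invRev, List.map_cons, List.map_nil, List.reverse_singleton, List.cons_append,
        List.cons.injEq] at hs ⊢
      rw [hs.1]
    refine key ([s] ++ G') hG.rotate ?_
    rw [← mul_mk, ← mul_mk, hst]
    group
  · by_contra hr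
    obtain ⟨s, V', G', hs, rfl⟩ := exists_cancel_of_not_isReduced_append hrV' hG.isReduced hr
    have hst : (mk [s])⁻¹ = mk [t] := by
      rw [hinv] at hs
      have := (List.append_inj' hs (by simp)).2
      rw [← this, inv_mk, invRev_invRev]
    refine key (G' ++ invRev [s]) hG.rotate ?_
    rw [← mul_mk, ← mul_mk, ← inv_mk, hst]
    group

/-- A longest segment along which the axes of `g` and `h` run in opposite directions. -/
theorem exists_conj_overlap {g h x : FreeGroup α} (hG : IsCyclicallyReduced G)
    (hC : IsCyclicallyReduced C) (hg : x * g * x⁻¹ = mk G) (hh : x * h * x⁻¹ = mk C) :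
    ∃ (x : FreeGroup α) (S A B : List (α × Bool)), IsCyclicallyReduced (S ++ A) ∧
      IsCyclicallyReduced (B ++ invRev S) ∧ x * g * x⁻¹ = mk (S ++ A) ∧
      x * h * x⁻¹ = mk (B ++ invRev S) ∧ IsReduced (A ++ B) ∧ IsReduced (B ++ A) := by
  let P (n : ℕ) : Prop := ∃ (x : FreeGroup α) (S A B : List (α × Bool)),
      IsCyclicallyReduced (S ++ A) ∧ IsCyclicallyReduced (B ++ invRev S) ∧
      x * g * x⁻¹ = mk (S ++ A) ∧ x * h * x⁻¹ = mk (B ++ invRev S) ∧ S.length = n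
  have := Classical.decPred P
  have hP0 : P 0 := ⟨x, [], G, C, by simpa, by simpa, by simpa, by simpa, rfl⟩
  have hbound : ∀ n, P n → n ≤ cyclLen g := by
    rintro _ ⟨y, S, A, B, hSA, -, hy, -, rfl⟩
    rw [cyclLen_eq_length hSA hy]
    simp
  obtain ⟨y, S, A, B, hSA, hBS, hgy, hhy, hn⟩ :=
    Nat.findGreatest_spec (P := P) (Nat.zero_le (cyclLen g)) hP0
  have hmax : ¬ P (S.length + 1) := fun hS ↦ by
    have := Nat.le_findGreatest (hbound _ hS) hS
    omega
  have hrA : IsReduced A := hSA.isReduced.infix ⟨S, [], by simp⟩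
  have hrB : IsReduced B := hBS.isReduced.infix ⟨[], invRev S, by simp⟩
  refine ⟨y, S, A, B, hSA, hBS, hgy, hhy, ?_, ?_⟩ <;> by_contra hr
  · obtain ⟨t, A, B, rfl, rfl⟩ := exists_cancel_of_not_isReduced_append hrA hrB hr
    have hinv : invRev ([t] ++ S) = invRev S ++ invRev [t] := invRev_append
    refine hmax ⟨mk [t] * y, [t] ++ S, A, B, ?_, ?_, ?_, ?_, by simp⟩
    · rw [List.append_assoc]
      exact IsCyclicallyReduced.rotate (by simpa using hSA)
    · rw [hinv, ← List.append_assoc]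
      exact IsCyclicallyReduced.rotate (by simpa using hBS)
    · calc _ = mk [t] * (y * g * y⁻¹) * (mk [t])⁻¹ := by group
        _ = _ := by rw [hgy]; simp only [← mul_mk]; group
    · calc _ = mk [t] * (y * h * y⁻¹) * (mk [t])⁻¹ := by group
        _ = _ := by rw [hhy, hinv]; simp only [← mul_mk, ← inv_mk]; group
  · obtain ⟨t, B, A, rfl, rfl⟩ := exists_cancel_of_not_isReduced_append hrB hrA hr
    have hinv : invRev (S ++ invRev [t]) = [t] ++ invRev S := by
      rw [invRev_append, invRev_invRev]
    exact hmax ⟨y, S ++ invRev [t], A, B, by simpa using hSA, by simpa [hinv] using hBS,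
      by simpa using hgy, by simpa [hinv] using hhy, by simp⟩

theorem exists_cyclLen_pow_mul_pow_eq {g h : FreeGroup α} (hgh : cyclLen g = cyclLen h)
    (hne : g ≠ h⁻¹) : ∃ c d : ℕ, ∀ p q : ℕ, 0 < p → 0 < q →
      cyclLen (g ^ p * h ^ q) + c = (p + q) * cyclLen g + d := by
  obtain ⟨x, G, V, C, hG, hC, hVC, hg, hh, hV⟩ := exists_conj_disjoint_or_cyclicallyReduced g h
  by_cases hV0 : V = []
  · subst hV0
    obtain ⟨y, S, A, B, hSA, hBS, hgy, hhy, hAB, hBA⟩ :=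
      exists_conj_overlap hG hC hg (by simpa using hh)
    have hlg := cyclLen_eq_length hSA hgy
    have hlh := cyclLen_eq_length hBS hhy
    have hlen : A.length = B.length := by
      rw [hlg, hlh] at hgh
      simp at hgh
      omega
    have hA : A ≠ [] := by
      rintro rfl
      obtain rfl : B = [] := List.length_eq_zero_iff.1 hlen.symm
      apply hne
      have : y * g * y⁻¹ = y * h⁻¹ * y⁻¹ := by
        rw [hgy, ← conj_inv, hhy, inv_mk]
        simp
      simpa using this
    have hB : B ≠ [] := by
      rintro rfl
      exact hA (List.length_eq_zero_iff.1 hlen)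
    refine ⟨2 * S.length, 0, fun p q hp hq ↦ ?_⟩
    rw [cyclLen_pow_mul_pow_of_overlap hSA hBS hA hB hAB hBA hgy hhy hp hq, ← hlg, ← hlh, ← hgh]
    ring
  · have hlg := cyclLen_eq_length hG hg
    have hlh : cyclLen h = C.length := cyclLen_eq_length (x := (mk V)⁻¹ * x) hC <| by
      calc _ = (mk V)⁻¹ * (x * h * x⁻¹) * mk V := by group
        _ = _ := by rw [hh, mk_conj]; group
    have hG0 : G ≠ [] := by
      rintro rfl
      have hg0 : cyclLen g = 0 := hlg
      have hh0 : cyclLen h = 0 := hgh ▸ hg0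
      exact hne (by rw [eq_one_of_cyclLen_eq_zero hg0, eq_one_of_cyclLen_eq_zero hh0, inv_one])
    refine ⟨0, 2 * V.length, fun p q hp hq ↦ ?_⟩
    rw [cyclLen_pow_mul_pow_of_disjoint hG hC hV0 hG0 hVC (hV hV0).1 (hV hV0).2 hg hh hp hq,
      ← hlg, ← hlh, ← hgh]
    ring

end FreeGroup

theorem power_redistribution_translation_equivalence {k : ℕ} (hk : 2 ≤ k)
    (g h : FreeGroup (Fin k)) (hgh : TransEquiv g h) (hne : g ≠ h⁻¹)
    (p q i j : ℕ) (hp : 0 < p) (hq : 0 < q) (hi : 0 < i) (hj : 0 < j)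
    (hsum : p + q = i + j) :
    TransEquiv (g ^ p * h ^ q) (g ^ i * h ^ j) := by
  intro φ
  have hφ : φ g ≠ (φ h)⁻¹ := by
    rw [← map_inv]
    exact φ.injective.ne hne
  obtain ⟨c, d, hcd⟩ := FreeGroup.exists_cyclLen_pow_mul_pow_eq (hgh φ) hφ
  have h₁ := hcd p q hp hq
  have h₂ := hcd i j hi hj
  rw [hsum] at h₁
  simp only [map_mul, map_pow]
  omega
end
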